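/- Let f : I → ℝ be strongly convex with modulus c and differentiable on the interior of I with continuous derivative f′, and let A be a self-adjoint bounded linear operator on a complex Hilbert space H whose spectrum is contained in the interior of I. Then for every unit vector x ∈ H, ⟨A²x, x⟩ − ⟨Ax, x⟩² ≤ (1/(2c))·( ⟨f′(A)Ax, x⟩ − ⟨Ax, x⟩·⟨f′(A)x, x⟩ ). -/

import Mathlib

open scoped InnerProductSpace

lemma aux_nonneg {H : Type*} [NormedAddCommGroup H] [InnerProductSpace ℂ H] [CompleteSpace H]
    (A : H →L[ℂ] H) (φ : ℝ → ℝ) (h : ∀ t ∈ spectrum ℝ A, 0 ≤ φ t) (x : H) :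
    0 ≤ (⟪(cfc φ A) x, x⟫_ℂ).re := by
  have h1 : 0 ≤ cfc φ A := cfc_nonneg h
  rw [ContinuousLinearMap.nonneg_iff_isPositive] at h1
  exact h1.re_inner_nonneg_left x

lemma aux_grad (J : Set ℝ) (hJ : J.OrdConnected) (f f' : ℝ → ℝ) (c : ℝ)
    (hf : ∀ x ∈ J, ∀ y ∈ J, ∀ l ∈ Set.Icc (0 : ℝ) 1,
      f (l * x + (1 - l) * y) ≤ l * f x + (1 - l) * f y - c * l * (1 - l) * (x - y) ^ 2)
    (hderiv : ∀ t ∈ J, HasDerivAt f (f' t) t) (s t : ℝ) (hs : s ∈ J) (ht : t ∈ J)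
    (hst : s < t) : 2 * c * (t - s) ≤ f' t - f' s := by
  have hconv : ConvexOn ℝ J (fun t => f t - c * t ^ 2) := by
    refine ⟨hJ.convex, ?_⟩
    intro x hx y hy a b ha hb hab
    obtain rfl : b = 1 - a := by linarith
    have := hf x hx y hy a ⟨ha, by linarith⟩
    simp only [smul_eq_mul]
    nlinarith
  have hd : ∀ t ∈ J, HasDerivAt (fun t => f t - c * t ^ 2) (f' t - c * (2 * t)) t := by
    intro t ht
    have := (hderiv t ht).sub (((hasDerivAt_id t).pow 2).const_mul c)
    exact this.congr_deriv (by simp)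
  have h1 := hconv.le_slope_of_hasDerivAt hs ht hst (hd s hs)
  have h2 := hconv.slope_le_of_hasDerivAt hs ht hst (hd t ht)
  linarith

/-- Additive reverse: for `f` strongly convex with modulus `c`, differentiable on
the interior of `I` with continuous derivative `f'`, and `A` self-adjoint with
spectrum in the interior of `I`,
`⟨A²x,x⟩ - ⟨Ax,x⟩² ≤ (1/(2c)) (⟨f'(A)Ax,x⟩ - ⟨Ax,x⟩⟨f'(A)x,x⟩)`. -/
theorem operator_variance_bound_strongly_convex
    {H : Type*} [NormedAddCommGroup H] [InnerProductSpace ℂ H] [CompleteSpace H]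
    (I : Set ℝ) (hI : I.OrdConnected) (f f' : ℝ → ℝ) (c : ℝ) (hc : 0 < c)
    (hf : ∀ x ∈ I, ∀ y ∈ I, ∀ l ∈ Set.Icc (0 : ℝ) 1,
      f (l * x + (1 - l) * y) ≤ l * f x + (1 - l) * f y - c * l * (1 - l) * (x - y) ^ 2)
    (hderiv : ∀ t ∈ interior I, HasDerivAt f (f' t) t)
    (hcont : ContinuousOn f' (interior I))
    (A : H →L[ℂ] H) (hA : IsSelfAdjoint A) (hspec : spectrum ℝ A ⊆ interior I)
    (x : H) (hx : ‖x‖ = 1) :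
    (⟪(A ^ 2) x, x⟫_ℂ).re - (⟪A x, x⟫_ℂ).re ^ 2 ≤
      1 / (2 * c) *
        ((⟪(cfc f' A) (A x), x⟫_ℂ).re -
          (⟪A x, x⟫_ℂ).re * (⟪(cfc f' A) x, x⟫_ℂ).re) := by
  have hx0 : x ≠ 0 := by
    rintro rfl
    simp at hx
  have : Nontrivial H := ⟨x, 0, hx0⟩
  have hxx : ⟪x, x⟫_ℂ = 1 := by
    rw [inner_self_eq_norm_sq_to_K, hx]; simp
  have hJ : (interior I).OrdConnected := hI.interior
  set m : ℝ := (⟪A x, x⟫_ℂ).re with hm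
  have hne : (spectrum ℝ A).Nonempty := ContinuousFunctionalCalculus.spectrum_nonempty A hA
  have hcpt : IsCompact (spectrum ℝ A) := ContinuousFunctionalCalculus.isCompact_spectrum A
  obtain ⟨a, ha, ha'⟩ := hcpt.exists_isLeast hne
  obtain ⟨b, hb, hb'⟩ := hcpt.exists_isGreatest hne
  have ham : a ≤ m := by
    have h := aux_nonneg A (fun t => t - a) (fun t ht => sub_nonneg.2 (ha' ht)) x
    rw [cfc_sub (fun t => t) (fun _ => a) A, cfc_id' ℝ A, cfc_const a A] at h
    simp [Algebra.algebraMap_eq_smul_one, inner_sub_left, inner_smul_left_eq_smul, hx] at h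
    linarith
  have hmb : m ≤ b := by
    have h := aux_nonneg A (fun t => b - t) (fun t ht => sub_nonneg.2 (hb' ht)) x
    rw [cfc_sub (fun _ => b) (fun t => t) A, cfc_id' ℝ A, cfc_const b A] at h
    simp [Algebra.algebraMap_eq_smul_one, inner_sub_left, inner_smul_left_eq_smul, hx] at h
    linarith
  have hmI : m ∈ interior I := hJ.out (hspec ha) (hspec hb) ⟨ham, hmb⟩
  have hf2 : ∀ x ∈ interior I, ∀ y ∈ interior I, ∀ l ∈ Set.Icc (0 : ℝ) 1,
      f (l * x + (1 - l) * y) ≤ l * f x + (1 - l) * f y - c * l * (1 - l) * (x - y) ^ 2 :=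
    fun x hx y hy => hf x (interior_subset hx) y (interior_subset hy)
  have hc' : ContinuousOn f' (spectrum ℝ A) := hcont.mono hspec
  have key := aux_nonneg A
    (fun t => (f' t * t - m * f' t) - ((2 * c) * t ^ 2 + ((f' m - 4 * c * m) * t
      + (2 * c * m ^ 2 - m * f' m)))) (by
    intro t ht
    have e : (f' t * t - m * f' t) - ((2 * c) * t ^ 2 + ((f' m - 4 * c * m) * t
      + (2 * c * m ^ 2 - m * f' m))) = (f' t - f' m - 2 * c * (t - m)) * (t - m) := by ring
    rw [e]
    rcases lt_trichotomy t m with h | h | h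
    · have := aux_grad _ hJ f f' c hf2 hderiv t m (hspec ht) hmI h
      exact mul_nonneg_of_nonpos_of_nonpos (by linarith) (by linarith)
    · simp [h]
    · have := aux_grad _ hJ f f' c hf2 hderiv m t hmI (hspec ht) h
      exact mul_nonneg (by linarith) (by linarith)) x
  rw [cfc_sub (fun t => f' t * t - m * f' t) _ A (by fun_prop) (by fun_prop),
    cfc_sub (fun t => f' t * t) (fun t => m * f' t) A (by fun_prop) (by fun_prop),
    cfc_mul f' (fun t => t) A (by fun_prop) (by fun_prop), cfc_const_mul m f' A (by fun_prop),
    cfc_add A (fun t => (2 * c) * t ^ 2) _ (by fun_prop) (by fun_prop),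
    cfc_add A (fun t => (f' m - 4 * c * m) * t) _ (by fun_prop) (by fun_prop),
    cfc_const_mul (2 * c) (fun t => t ^ 2) A (by fun_prop),
    cfc_const_mul _ (fun t => t) A (by fun_prop),
    cfc_pow (fun t => t) 2 A (by fun_prop), cfc_id' ℝ A, cfc_const _ A,
    Algebra.algebraMap_eq_smul_one] at key
  simp only [sub_apply, add_apply,
    smul_apply, one_apply_eq_self,
    inner_sub_left, inner_add_left, inner_smul_left_eq_smul, hxx, Complex.sub_re, Complex.add_re,
    Complex.smul_re, Complex.one_re, smul_eq_mul, ← hm] at key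
  have hmul : (cfc f' A * A) x = (cfc f' A) (A x) := rfl
  rw [hmul] at key
  rw [one_div, ← div_eq_inv_mul, le_div_iff₀ (by positivity)]
  nlinarith
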